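/- Assume S is infinite and let T be any set of L-sentences. Then the domain and codomain maps d, c : I_T → M_T are open maps with respect to the subspace logical topologies; in particular, the topological groupoid of S-indexed T-models and isomorphisms is an open topological groupoid. -/

import Mathlib

open FirstOrder Language Set Topology TopologicalSpace Cardinal

universe u v w

namespace SemGpd

variable (L : FirstOrder.Language.{u, v}) (S : Type w)

/-- An `S`-indexed `L`-structure: a subset `A ⊆ S`, an equivalence relation `≈` on `A`,
and an `L`-structure on the quotient `A/≈`. -/
structure IndexedStructure where
  A : Set S
  r : Setoid A
  str : L.Structure (Quotient r)

variable {L S}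

/-- The underlying set (carrier) `A/≈` of an indexed structure. -/
abbrev IndexedStructure.carrier (M : IndexedStructure L S) : Type w := Quotient M.r

/-- The equivalence class of an indexed element. -/
def IndexedStructure.cls (M : IndexedStructure L S) (a : S) (h : a ∈ M.A) : M.carrier :=
  Quotient.mk M.r ⟨a, h⟩

/-- Satisfaction of a formula in an indexed structure under an assignment. -/
def IndexedStructure.Sat (M : IndexedStructure L S) {α : Type*} (φ : L.Formula α)
    (v : α → M.carrier) : Prop :=
  letI := M.str
  φ.Realize v

/-- Satisfaction of a sentence in an indexed structure. -/
def IndexedStructure.SatSentence (M : IndexedStructure L S) (σ : L.Sentence) : Prop :=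
  letI := M.str
  M.carrier ⊨ σ

/-- `M` is an `S`-indexed model of the theory `T`. -/
def IndexedStructure.models (M : IndexedStructure L S) (T : Set L.Sentence) : Prop :=
  ∀ σ ∈ T, M.SatSentence σ

variable (L S)

/-- The basic set `⟨φ, a⟩` of indexed structures. -/
def fSet {n : ℕ} (φ : L.Formula (Fin n)) (a : Fin n → S) : Set (IndexedStructure L S) :=
  {M | ∃ h : ∀ i, a i ∈ M.A, M.Sat φ fun i => M.cls (a i) (h i)}

/-- The basic set `⟨a⟩` of structures in which `a` is indexed. -/
def membSet (a : S) : Set (IndexedStructure L S) :=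
  {M | a ∈ M.A}

/-- The logical topology on the space of `S`-indexed `L`-structures, generated by the
membership conditions `⟨a⟩` and the atomic conditions `⟨φ, a⟩` for `φ` atomic (which include
the relation conditions `⟨R,a⟩`, the function conditions `⟨f(a)=b⟩` and equality conditions). -/
def logicalTopology : TopologicalSpace (IndexedStructure L S) :=
  generateFrom {U | (∃ a : S, U = membSet L S a) ∨
    ∃ (n : ℕ) (φ : L.Formula (Fin n)), BoundedFormula.IsAtomic φ ∧
      ∃ a : Fin n → S, U = fSet L S φ a}

instance : TopologicalSpace (IndexedStructure L S) := logicalTopology L S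

/-- An isomorphism between `S`-indexed `L`-structures. -/
structure IndexedIso where
  dom : IndexedStructure L S
  cod : IndexedStructure L S
  iso : @Language.Equiv L dom.carrier cod.carrier dom.str cod.str

variable {L S}

/-- Application of an isomorphism of indexed structures to an element of the domain. -/
def IndexedIso.map (F : IndexedIso L S) (x : F.dom.carrier) : F.cod.carrier :=
  (@Language.Equiv.toEquiv L F.dom.carrier F.cod.carrier F.dom.str F.cod.str F.iso) x

/-- The basic set `⟨a ↦ b⟩` of isomorphisms. -/
def mapSet (a b : S) : Set (IndexedIso L S) :=
  {F | ∃ (ha : a ∈ F.dom.A) (hb : b ∈ F.cod.A),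
    F.map (F.dom.cls a ha) = F.cod.cls b hb}

variable (L S)

/-- The logical topology on the space of isomorphisms of `S`-indexed `L`-structures:
the coarsest topology making `dom` and `cod` continuous and containing each `⟨a ↦ b⟩`. -/
def isoTopology : TopologicalSpace (IndexedIso L S) :=
  ((logicalTopology L S).induced IndexedIso.dom) ⊓
    ((logicalTopology L S).induced IndexedIso.cod) ⊓
    generateFrom {V | ∃ a b : S, V = mapSet a b}

instance : TopologicalSpace (IndexedIso L S) := isoTopology L S

variable {L S}

/-- The identity isomorphism. -/
def idIso (M : IndexedStructure L S) : IndexedIso L S :=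
  ⟨M, M, by letI := M.str; exact Language.Equiv.refl L M.carrier⟩

/-- The inverse of an isomorphism of indexed structures. -/
def IndexedIso.inv (F : IndexedIso L S) : IndexedIso L S :=
  ⟨F.cod, F.dom, by letI := F.dom.str; letI := F.cod.str; exact F.iso.symm⟩

/-- The composite of two composable isomorphisms of indexed structures. -/
def IndexedIso.comp (F G : IndexedIso L S) (h : F.cod = G.dom) : IndexedIso L S :=
  ⟨F.dom, G.cod, by
    letI := F.dom.str; letI := F.cod.str; letI := G.cod.str
    exact Language.Equiv.comp (by rw [h]; exact G.iso) F.iso⟩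

variable (L S)

/-- The space of composable pairs of isomorphisms, as a subspace of the product. -/
def CompPairs := {p : IndexedIso L S × IndexedIso L S // p.1.cod = p.2.dom}

instance : TopologicalSpace (CompPairs L S) :=
  instTopologicalSpaceSubtype

/-- The space `M_T` of `S`-indexed models of `T`, as a subspace of `M_L`. -/
abbrev ModelsT (T : Set L.Sentence) := {M : IndexedStructure L S // M.models T}

/-- The space `I_T` of isomorphisms between `S`-indexed models of `T`, as a subspace of `I_L`. -/
abbrev IsoT (T : Set L.Sentence) := {F : IndexedIso L S // F.dom.models T ∧ F.cod.models T}

variable {L S}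

/-- The domain map `d : I_T → M_T`. -/
def IsoT.d {T : Set L.Sentence} (F : IsoT L S T) : ModelsT L S T := ⟨F.1.dom, F.2.1⟩

/-- The codomain map `c : I_T → M_T`. -/
def IsoT.c {T : Set L.Sentence} (F : IsoT L S T) : ModelsT L S T := ⟨F.1.cod, F.2.2⟩

/-- Horn formulas: finite conjunctions of atomic formulas (including `⊤`). -/
inductive IsHorn {α : Type*} : ∀ {n : ℕ}, L.BoundedFormula α n → Prop
  | top {n : ℕ} : IsHorn (⊤ : L.BoundedFormula α n)
  | equal {n : ℕ} (t₁ t₂ : L.Term (α ⊕ Fin n)) : IsHorn (t₁.bdEqual t₂)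
  | rel {n k : ℕ} (R : L.Relations k) (ts : Fin k → L.Term (α ⊕ Fin n)) :
      IsHorn (R.boundedFormula ts)
  | inf {n : ℕ} {φ ψ : L.BoundedFormula α n} : IsHorn φ → IsHorn ψ → IsHorn (φ ⊓ ψ)

/-- Coherent formulas: built from atomic formulas, `⊤` and `⊥` by `∧`, `∨` and `∃`. -/
inductive IsCoherent {α : Type*} : ∀ {n : ℕ}, L.BoundedFormula α n → Prop
  | falsum {n : ℕ} : IsCoherent (⊥ : L.BoundedFormula α n)
  | top {n : ℕ} : IsCoherent (⊤ : L.BoundedFormula α n)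
  | equal {n : ℕ} (t₁ t₂ : L.Term (α ⊕ Fin n)) : IsCoherent (t₁.bdEqual t₂)
  | rel {n k : ℕ} (R : L.Relations k) (ts : Fin k → L.Term (α ⊕ Fin n)) :
      IsCoherent (R.boundedFormula ts)
  | inf {n : ℕ} {φ ψ : L.BoundedFormula α n} : IsCoherent φ → IsCoherent ψ → IsCoherent (φ ⊓ ψ)
  | sup {n : ℕ} {φ ψ : L.BoundedFormula α n} : IsCoherent φ → IsCoherent ψ → IsCoherent (φ ⊔ ψ)
  | ex {n : ℕ} {φ : L.BoundedFormula α (n + 1)} : IsCoherent φ → IsCoherent φ.ex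

/-- A coherent sequent: a sentence of the form `∀ x₁ … xₙ (φ → ψ)` with `φ, ψ` coherent. -/
def IsCoherentSequent (σ : L.Sentence) : Prop :=
  ∃ (n : ℕ) (φ ψ : L.BoundedFormula Empty n),
    IsCoherent φ ∧ IsCoherent ψ ∧ σ = (φ.imp ψ).alls


variable (L S)

/-- The sheaf `D_φ` of realizations of `φ` over the space of `S`-indexed models of `T`. -/
structure DSet (T : Set L.Sentence) {n : ℕ} (φ : L.Formula (Fin n)) where
  str : IndexedStructure L S
  mods : str.models T
  tup : Fin n → str.carrier
  sat : str.Sat φ tup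

variable {L S}

/-- The projection `π₁ : D_φ → M_T`. -/
def DSet.pi {T : Set L.Sentence} {n : ℕ} {φ : L.Formula (Fin n)} (d : DSet L S T φ) :
    ModelsT L S T := ⟨d.str, d.mods⟩

variable (L S)

/-- The image of the section `s_a : ⟨φ,a⟩ ∩ M_T → D_φ`. -/
def secImage (T : Set L.Sentence) {n : ℕ} (φ : L.Formula (Fin n)) (a : Fin n → S) :
    Set (DSet L S T φ) :=
  {d | ∃ h : ∀ i, a i ∈ d.str.A, d.tup = fun i => d.str.cls (a i) (h i)}

/-- The logical topology on `D_φ`: the coarsest topology making `π₁` continuous and making the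
image of every section `s_a` open. -/
def dTopology (T : Set L.Sentence) {n : ℕ} (φ : L.Formula (Fin n)) :
    TopologicalSpace (DSet L S T φ) :=
  (TopologicalSpace.induced DSet.pi inferInstance) ⊓
    generateFrom {V | ∃ a : Fin n → S, V = secImage L S T φ a}

instance {T : Set L.Sentence} {n : ℕ} {φ : L.Formula (Fin n)} :
    TopologicalSpace (DSet L S T φ) := dTopology L S T φ

/-- The basic open set `⟨ψ, b⟩` of `D_φ`. -/
def dBasic (T : Set L.Sentence) {n : ℕ} (φ : L.Formula (Fin n)) {m : ℕ}
    (ψ : L.Formula (Fin n ⊕ Fin m)) (b : Fin m → S) : Set (DSet L S T φ) :=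
  {d | ∃ h : ∀ j, b j ∈ d.str.A,
    d.str.Sat ψ (Sum.elim d.tup fun j => d.str.cls (b j) (h j))}

/-- The fiber product `I_T ×_{M_T} D_φ` of composable pairs for the application action. -/
def ActPairs (T : Set L.Sentence) {n : ℕ} (φ : L.Formula (Fin n)) :=
  {p : IsoT L S T × DSet L S T φ // p.1.1.dom = p.2.str}

instance {T : Set L.Sentence} {n : ℕ} {φ : L.Formula (Fin n)} :
    TopologicalSpace (ActPairs L S T φ) := instTopologicalSpaceSubtype

variable {L S}

/-- Isomorphisms of indexed structures preserve satisfaction. -/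
theorem IndexedIso.sat_map (F : IndexedIso L S) {α : Type*} (φ : L.Formula α)
    (v : α → F.dom.carrier) (h : F.dom.Sat φ v) :
    F.cod.Sat φ fun i => F.map (v i) := by
  letI := F.dom.str
  letI := F.cod.str
  have := (StrongHomClass.realize_formula (F.iso) φ (v := v)).mpr h
  exact this

/-- Transport of satisfaction along an equality of indexed structures. -/
theorem sat_cast {M N : IndexedStructure L S} (h : M = N) {α : Type*} (φ : L.Formula α)
    (v : α → N.carrier) (hs : N.Sat φ v) :
    M.Sat φ fun i => cast (congrArg IndexedStructure.carrier h.symm) (v i) := by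
  subst h; exact hs

/-- The application action `θ : I_T ×_{M_T} D_φ → D_φ`. -/
def act {T : Set L.Sentence} {n : ℕ} {φ : L.Formula (Fin n)} (p : ActPairs L S T φ) :
    DSet L S T φ where
  str := p.1.1.1.cod
  mods := p.1.1.2.2
  tup := fun i =>
    p.1.1.1.map (cast (congrArg IndexedStructure.carrier p.2.symm) (p.1.2.tup i))
  sat := p.1.1.1.sat_map φ _ (sat_cast p.2 φ p.1.2.tup p.1.2.sat)

/-- A subset of `D_φ` is stable if it is closed under the application action. -/
def Stable {T : Set L.Sentence} {n : ℕ} {φ : L.Formula (Fin n)}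
    (X : Set (DSet L S T φ)) : Prop :=
  ∀ p : ActPairs L S T φ, p.1.2 ∈ X → act p ∈ X

/-- The stabilization of a subset of `D_φ`: the smallest stable subset containing it. -/
def stabilization {T : Set L.Sentence} {n : ℕ} {φ : L.Formula (Fin n)}
    (X : Set (DSet L S T φ)) : Set (DSet L S T φ) :=
  ⋂₀ {Y | X ⊆ Y ∧ Stable Y}

/-- The set `{(M,m) ∈ D_φ : M ⊨ ∃y ψ(m,y)}`. -/
def exSet {T : Set L.Sentence} {n : ℕ} (φ : L.Formula (Fin n)) {m : ℕ}
    (ψ : L.Formula (Fin n ⊕ Fin m)) : Set (DSet L S T φ) :=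
  {d | ∃ w : Fin m → d.str.carrier, d.str.Sat ψ (Sum.elim d.tup w)}

/-- The identity isomorphism on a model of `T`, as an element of `I_T`. -/
def idIsoT {T : Set L.Sentence} (M : ModelsT L S T) : IsoT L S T :=
  ⟨idIso M.1, M.2, M.2⟩

/-- The inverse, in `I_T`. -/
def IsoT.inv {T : Set L.Sentence} (F : IsoT L S T) : IsoT L S T :=
  ⟨F.1.inv, F.2.2, F.2.1⟩

/-- The composite, in `I_T`. -/
def IsoT.comp {T : Set L.Sentence} (F G : IsoT L S T) (h : F.1.cod = G.1.dom) : IsoT L S T :=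
  ⟨F.1.comp G.1 h, F.2.1, G.2.2⟩



variable {L : FirstOrder.Language.{u, v}} {S : Type w}

/-- The isomorphism from `M` onto the structure that a surjection `q : A → M.carrier`
indexes by `A`. -/
noncomputable def reindex (M : IndexedStructure L S) (A : Set S) (q : A → M.carrier)
    (hq : Function.Surjective q) : IndexedIso L S :=
  letI := M.str
  let e : M.carrier ≃ Quotient (Setoid.ker q) := (Setoid.quotientKerEquivOfSurjective q hq).symm
  ⟨M, ⟨A, Setoid.ker q, e.inducedStructure⟩, e.inducedStructureEquiv⟩

theorem reindex_map (M : IndexedStructure L S) (A : Set S) (q : A → M.carrier)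
    (hq : Function.Surjective q) (x : A) :
    (reindex M A q hq).map (q x) = (reindex M A q hq).cod.cls x x.2 :=
  (Setoid.quotientKerEquivOfSurjective q hq).symm_apply_apply (Quotient.mk _ x)

theorem IndexedIso.models_iff (F : IndexedIso L S) (T : Set L.Sentence) :
    F.dom.models T ↔ F.cod.models T := by
  let := F.dom.str
  let := F.cod.str
  exact forall₂_congr fun σ _ => StrongHomClass.realize_sentence F.iso σ

theorem IndexedIso.inv_map_map (F : IndexedIso L S) (x : F.dom.carrier) :
    F.inv.map (F.map x) = x :=
  (@Language.Equiv.toEquiv L F.dom.carrier F.cod.carrier F.dom.str F.cod.str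
    F.iso).symm_apply_apply x

theorem IndexedIso.map_inv_map (F : IndexedIso L S) (x : F.cod.carrier) :
    F.map (F.inv.map x) = x :=
  (@Language.Equiv.toEquiv L F.dom.carrier F.cod.carrier F.dom.str F.cod.str
    F.iso).apply_symm_apply x

theorem IndexedStructure.exists_cls_eq (M : IndexedStructure L S) (x : M.carrier) :
    ∃ (a : S) (h : a ∈ M.A), M.cls a h = x :=
  Quotient.inductionOn x fun a => ⟨a, a.2, rfl⟩

/-- An embedding of an infinite set into the complement of any of its finite subsets. -/
theorem exists_injective_notMem_finite [Infinite S] {B : Set S} (hB : B.Finite) :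
    ∃ h : S → S, Function.Injective h ∧ ∀ a, h a ∉ B := by
  have hcard : #(Bᶜ : Set S) = #S :=
    mk_compl_of_infinite B (hB.lt_aleph0.trans_le (aleph0_le_mk S))
  obtain ⟨e⟩ := Cardinal.eq.1 hcard.symm
  exact ⟨fun a => e a, Subtype.val_injective.comp e.injective, fun a => (e a).2⟩

/-- Every structure is isomorphic to one in which finitely many indices are prescribed. -/
theorem exists_iso_mem_mapSet [Infinite S] (M : IndexedStructure L S) {B : Set S}
    (hB : B.Finite) (g : S → S) (hg : ∀ b ∈ B, g b ∈ M.A) :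
    ∃ F : IndexedIso L S, F.dom = M ∧ ∀ b ∈ B, F ∈ mapSet (g b) b := by
  obtain ⟨h, hinj, hmem⟩ := exists_injective_notMem_finite hB
  have key : ∀ x : (B ∪ h '' M.A : Set S), ∃ y : M.carrier,
      (∀ hx : x.1 ∈ B, y = M.cls (g x) (hg x hx)) ∧
        ∀ (a : S) (ha : a ∈ M.A), x.1 = h a → y = M.cls a ha := by
    rintro ⟨x, hx | ⟨a, ha, rfl⟩⟩
    · refine ⟨M.cls (g x) (hg x hx), fun _ => rfl, ?_⟩
      rintro a _ rfl
      exact absurd hx (hmem a)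
    · refine ⟨M.cls a ha, fun hx => absurd hx (hmem a), fun a' _ haa' => ?_⟩
      obtain rfl := hinj haa'
      rfl
  choose q hqB hqh using key
  have hq : Function.Surjective q := fun y => by
    obtain ⟨a, ha, rfl⟩ := M.exists_cls_eq y
    exact ⟨⟨h a, Or.inr ⟨a, ha, rfl⟩⟩, hqh _ a ha rfl⟩
  refine ⟨reindex M _ q hq, rfl, fun b hb => ⟨hg b hb, Or.inl hb, ?_⟩⟩
  have := reindex_map M _ q hq ⟨b, Or.inl hb⟩
  rwa [hqB _ hb] at this

theorem isOpen_membSet (a : S) : IsOpen (membSet L S a) :=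
  isOpen_generateFrom_of_mem (Or.inl ⟨a, rfl⟩)

theorem isOpen_fSet {n : ℕ} {φ : L.Formula (Fin n)} (hφ : BoundedFormula.IsAtomic φ)
    (a : Fin n → S) : IsOpen (fSet L S φ a) :=
  isOpen_generateFrom_of_mem (Or.inr ⟨n, φ, hφ, a, rfl⟩)

theorem isOpen_setOf_cls_eq (a b : S) :
    IsOpen {M : IndexedStructure L S | ∃ (ha : a ∈ M.A) (hb : b ∈ M.A),
      M.cls a ha = M.cls b hb} := by
  convert isOpen_fSet (L := L) (φ := Term.equal (Term.var (0 : Fin 2)) (Term.var 1))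
    (BoundedFormula.IsAtomic.equal _ _) ![a, b] using 1
  ext M
  let := M.str
  constructor
  · rintro ⟨ha, hb, h⟩
    refine ⟨Fin.forall_fin_two.2 ⟨ha, hb⟩, ?_⟩
    exact Formula.realize_equal.2 h
  · rintro ⟨hab, h⟩
    exact ⟨hab 0, hab 1, Formula.realize_equal.1 h⟩

theorem continuous_dom : Continuous (IndexedIso.dom : IndexedIso L S → IndexedStructure L S) :=
  continuous_iff_le_induced.2 (inf_le_left.trans inf_le_left)

theorem continuous_cod : Continuous (IndexedIso.cod : IndexedIso L S → IndexedStructure L S) :=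
  continuous_iff_le_induced.2 (inf_le_left.trans inf_le_right)

theorem isOpen_mapSet (a b : S) : IsOpen (mapSet a b : Set (IndexedIso L S)) :=
  (inf_le_right : isoTopology L S ≤ _) _ (isOpen_generateFrom_of_mem ⟨a, b, rfl⟩)

theorem IndexedIso.inv_mem_mapSet {F : IndexedIso L S} {a b : S} (h : F ∈ mapSet b a) :
    F.inv ∈ mapSet a b := by
  obtain ⟨hb, ha, h⟩ := h
  exact ⟨ha, hb, (congrArg F.inv.map h.symm).trans (F.inv_map_map _)⟩

theorem IndexedIso.cod_mem_fSet (F : IndexedIso L S) {n : ℕ} {φ : L.Formula (Fin n)}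
    {a b : Fin n → S} (h : ∀ i, F ∈ mapSet (a i) (b i)) (hF : F.dom ∈ fSet L S φ a) :
    F.cod ∈ fSet L S φ b := by
  refine ⟨fun i => (h i).2.1, ?_⟩
  obtain ⟨ha, hsat⟩ := hF
  have := F.sat_map φ _ hsat
  rwa [funext fun i => (h i).2.2] at this

theorem continuous_inv : Continuous (IndexedIso.inv : IndexedIso L S → IndexedIso L S) := by
  refine continuous_iff_le_induced.2 ?_
  change _ ≤ (isoTopology L S).induced IndexedIso.inv
  rw [isoTopology, induced_inf, induced_inf]
  refine le_inf (le_inf ?_ ?_) ?_ <;> refine continuous_iff_le_induced.1 ?_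
  · exact continuous_induced_rng.2 continuous_cod
  · exact continuous_induced_rng.2 continuous_dom
  · refine continuous_generateFrom_iff.2 ?_
    rintro _ ⟨a, b, rfl⟩
    convert isOpen_mapSet (L := L) b a using 1
    ext F
    exact ⟨fun h => IndexedIso.inv_mem_mapSet h, fun h => IndexedIso.inv_mem_mapSet h⟩

theorem IndexedIso.nhds_eq (F : IndexedIso L S) :
    𝓝 F = Filter.comap IndexedIso.dom (𝓝 F.dom) ⊓ Filter.comap IndexedIso.cod (𝓝 F.cod) ⊓
      ⨅ s ∈ {s | F ∈ s ∧ s ∈ {V | ∃ a b : S, V = mapSet a b}}, Filter.principal s := by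
  let t₁ := (logicalTopology L S).induced (IndexedIso.dom (L := L) (S := S))
  let t₂ := (logicalTopology L S).induced (IndexedIso.cod (L := L) (S := S))
  let t₃ := generateFrom {V : Set (IndexedIso L S) | ∃ a b : S, V = mapSet a b}
  have h := @_root_.nhds_inf _ (t₁ ⊓ t₂) t₃ F
  have h₁₂ := @_root_.nhds_inf _ t₁ t₂ F
  exact h.trans (congrArg₂ _ (h₁₂.trans (congrArg₂ _ (@nhds_induced _ _ (logicalTopology L S) _ F)
    (@nhds_induced _ _ (logicalTopology L S) _ F))) nhds_generateFrom)

/-- If `g` lifts the indices of the codomain of `F` along `F`, then neighbourhoods of `F` are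
controlled by neighbourhoods of its domain and the sets `⟨g b ↦ b⟩`. -/
theorem comap_dom_inf_le_nhds (F : IndexedIso L S) (g : S → S)
    (hg : ∀ b ∈ F.cod.A, F ∈ mapSet (g b) b) :
    Filter.comap IndexedIso.dom (𝓝 F.dom) ⊓
      (⨅ b : F.cod.A, Filter.principal (mapSet (g b) b.1)) ≤ 𝓝 F := by
  have hmap (b : S) (hb : b ∈ F.cod.A) : mapSet (g b) b ∈
      Filter.comap IndexedIso.dom (𝓝 F.dom) ⊓
        (⨅ b : F.cod.A, Filter.principal (mapSet (g b) b.1)) :=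
    Filter.mem_inf_of_right <| Filter.mem_iInf_of_mem (⟨b, hb⟩ : F.cod.A)
      (Filter.mem_principal_self _)
  have hdom {U : Set (IndexedStructure L S)} (hU : IsOpen U) (hF : F.dom ∈ U) :
      IndexedIso.dom ⁻¹' U ∈ Filter.comap IndexedIso.dom (𝓝 F.dom) ⊓
        (⨅ b : F.cod.A, Filter.principal (mapSet (g b) b.1)) :=
    Filter.mem_inf_of_left (Filter.preimage_mem_comap (hU.mem_nhds hF))
  rw [F.nhds_eq]
  refine le_inf (le_inf inf_le_left ?_) ?_
  · rw [← Filter.tendsto_iff_comap]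
    refine tendsto_nhds_generateFrom_iff.2 ?_
    rintro _ (⟨a, rfl⟩ | ⟨n, φ, hφ, a, rfl⟩) hF
    · filter_upwards [hmap a hF] with G hG using hG.2.1
    · have ha := hF.1
      have hdomF : F.dom ∈ fSet L S φ fun i => g (a i) :=
        F.inv.cod_mem_fSet (fun i => IndexedIso.inv_mem_mapSet (hg _ (ha i))) hF
      filter_upwards [hdom (isOpen_fSet hφ _) hdomF,
        Filter.eventually_all.2 fun i => hmap (a i) (ha i)] with G hG hGa
      exact G.cod_mem_fSet hGa hG
  · refine le_iInf₂ fun s hs => ?_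
    obtain ⟨hF, a, b, rfl⟩ := hs
    rw [Filter.le_principal_iff]
    obtain ⟨ha, hb, hab⟩ := hF
    obtain ⟨hgb, _, hgab⟩ := hg b hb
    have heq : F.dom.cls a ha = F.dom.cls (g b) hgb := by
      rw [← F.inv_map_map (F.dom.cls a ha), hab, ← hgab, F.inv_map_map]
    filter_upwards [hmap b hb, hdom (isOpen_setOf_cls_eq a (g b)) ⟨ha, hgb, heq⟩]
      with G hG hGab
    obtain ⟨ha', _, hGab⟩ := hGab
    exact ⟨ha', hG.2.1, by rw [hGab]; exact hG.2.2⟩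

theorem isOpenMap_dom [Infinite S] :
    IsOpenMap (IndexedIso.dom : IndexedIso L S → IndexedStructure L S) := by
  refine isOpenMap_iff_nhds_le.2 fun F W hW => ?_
  have hlift (b : S) : ∃ a, b ∈ F.cod.A → F ∈ mapSet a b := by
    by_cases hb : b ∈ F.cod.A
    · obtain ⟨a, ha, h⟩ := F.dom.exists_cls_eq (F.inv.map (F.cod.cls b hb))
      exact ⟨a, fun _ => ⟨ha, hb, by rw [h, F.map_inv_map]⟩⟩
    · exact ⟨b, fun h => absurd h hb⟩
  choose g hg using hlift
  obtain ⟨V, ⟨U, hU, hUV⟩, V', hV', hVW⟩ :=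
    Filter.mem_inf_iff_superset.1 (comap_dom_inf_le_nhds F g hg hW)
  obtain ⟨B, hB, hBV⟩ := (Filter.hasBasis_iInf_principal_finite _).mem_iff.1 hV'
  have hmem : (⋂ b ∈ B, membSet L S (g b.1)) ∈ 𝓝 F.dom :=
    (Filter.biInter_mem hB).2 fun b _ => (isOpen_membSet _).mem_nhds (hg b b.2).1
  filter_upwards [hU, hmem] with M hMU hM
  obtain ⟨G, rfl, hG⟩ := exists_iso_mem_mapSet M (hB.image Subtype.val) g <| by
    rintro _ ⟨b, hb, rfl⟩
    exact mem_iInter₂.1 hM b hb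
  exact hVW ⟨hUV hMU, hBV (mem_iInter₂.2 fun b hb => hG b ⟨b, hb, rfl⟩)⟩

theorem IsoT.isOpenMap_d [Infinite S] (T : Set L.Sentence) :
    IsOpenMap (IsoT.d : IsoT L S T → ModelsT L S T) := by
  rintro _ ⟨W, hW, rfl⟩
  refine ⟨_, isOpenMap_dom W hW, ?_⟩
  ext ⟨M, hM⟩
  constructor
  · rintro ⟨F, hF, rfl⟩
    exact ⟨⟨F, hM, (F.models_iff T).1 hM⟩, hF, rfl⟩
  · rintro ⟨F, hF, h⟩
    exact ⟨F.1, hF, congrArg Subtype.val h⟩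

theorem IsoT.continuous_inv (T : Set L.Sentence) :
    Continuous (IsoT.inv : IsoT L S T → IsoT L S T) :=
  (SemGpd.continuous_inv.comp continuous_subtype_val).subtype_mk _

theorem IsoT.isOpenMap_c [Infinite S] (T : Set L.Sentence) :
    IsOpenMap (IsoT.c : IsoT L S T → ModelsT L S T) := by
  intro W hW
  convert IsoT.isOpenMap_d T _ (hW.preimage (IsoT.continuous_inv T)) using 1
  ext M
  constructor
  · rintro ⟨F, hF, rfl⟩
    exact ⟨F.inv, hF, rfl⟩
  · rintro ⟨F, hF, rfl⟩
    exact ⟨F.inv, hF, rfl⟩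

theorem stmt8 [Infinite S] (T : Set L.Sentence) :
    IsOpenMap (IsoT.d : IsoT L S T → ModelsT L S T) ∧
    IsOpenMap (IsoT.c : IsoT L S T → ModelsT L S T) :=
  ⟨IsoT.isOpenMap_d T, IsoT.isOpenMap_c T⟩

end SemGpd
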